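/- arXiv:2304.11690 — 4 statements merged into one kernel-verified Lean document; each statement's English description precedes it below -/
import Mathlib

section
/- Let {a_ij} and {b_jk} be ν×ν matrices of nonnegative integers with Σ_i a_ij = n_j and Σ_j a_ij = n_i, and Σ_j b_jk = n_k and Σ_k b_jk = n_j, and let t_ijk (1 ≤ i, j, k ≤ ν) be nonnegative integers with Σ_k t_ijk = a_ij and Σ_i t_ijk = b_jk for all i, j, k. Then the number of pairs (g, h) ∈ Sym(Ω) × Sym(Ω) such that #(g(P_i) ∩ P_j) = a_ij, #(h(P_j) ∩ P_k) = b_jk, and #(g(P_i) ∩ P_j ∩ h^{-1}(P_k)) = t_ijk for all i, j, k, equals (∏_j n_j! / ∏_{i,j,k} t_ijk!)³ · ∏_{i,j,k} (t_ijk!)². -/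
open Finset

def countMat {Ω : Type} [Fintype Ω] [DecidableEq Ω] {ν : ℕ}
    (P : Fin ν → Finset Ω) (g : Equiv.Perm Ω) (i j : Fin ν) : ℕ :=
  ((P i).image ⇑g ∩ P j).card

def IsPartition {Ω : Type} [Fintype Ω] {ν : ℕ} (n : Fin ν → ℕ) (P : Fin ν → Finset Ω) : Prop :=
  (∀ i j, i ≠ j → Disjoint (P i) (P j)) ∧ (∀ x : Ω, ∃ j, x ∈ P j) ∧ ∀ j, (P j).card = n j

def IsDC {ν : ℕ} (n : Fin ν → ℕ) (a : Fin ν → Fin ν → ℕ) : Prop :=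
  (∀ j, ∑ i, a i j = n j) ∧ ∀ i, ∑ j, a i j = n i

open Equiv in
/-- Colourings with equal fibre sizes differ by a permutation of the domain. -/
theorem exists_perm_comp_eq {α κ : Type*} [Fintype α] [DecidableEq κ] (f f' : α → κ)
    (h : ∀ k, #{x | f' x = k} = #{x | f x = k}) : ∃ σ : Perm α, f ∘ σ = f' := by
  have e : ∀ k, Nonempty ({x // f' x = k} ≃ {x // f x = k}) := fun k =>
    ⟨Fintype.equivOfCardEq (by simpa [Fintype.card_subtype] using h k)⟩
  replace e := fun k => (e k).some
  refine ⟨(sigmaFiberEquiv f').symm.trans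
    ((sigmaCongrRight e).trans (sigmaFiberEquiv f)), ?_⟩
  funext x
  exact (e (f' x) ⟨x, rfl⟩).2

/-- The number of permutations carrying one colouring to another with the same fibre sizes. -/
theorem card_perm_comp_eq {α κ : Type*} [Fintype α] [DecidableEq α] [Fintype κ] [DecidableEq κ]
    (f f' : α → κ) (h : ∀ k, #{x | f' x = k} = #{x | f x = k}) :
    #{σ : Equiv.Perm α | f ∘ σ = f'} = ∏ k, (#{x | f x = k}).factorial := by
  obtain ⟨τ, rfl⟩ := exists_perm_comp_eq f f' h
  have key : #{σ : Equiv.Perm α | f ∘ σ = f} = ∏ k, (#{x | f x = k}).factorial := by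
    have := DomMulAct.stabilizer_card f
    simpa only [Fintype.card_subtype] using this
  rw [← key]
  refine Finset.card_equiv (Equiv.mulRight τ⁻¹) fun σ => ?_
  simp only [mem_filter, mem_univ, true_and, Equiv.coe_mulRight, funext_iff, Function.comp_apply,
    Equiv.Perm.mul_apply]
  exact ⟨fun H x => by simpa using H (τ⁻¹ x), fun H x => by simpa using H (τ x)⟩

/-- Permutations carrying one colouring to another exist only if the fibre sizes agree. -/
theorem card_fiber_eq_of_comp_eq {α κ : Type*} [Fintype α] [DecidableEq κ] {f f' : α → κ}
    {σ : Equiv.Perm α} (h : f ∘ σ = f') (k : κ) : #{x | f' x = k} = #{x | f x = k} := by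
  subst h
  exact Finset.card_equiv σ (by simp)

/-- Any prescribed fibre sizes with the right total are attained. -/
theorem exists_card_fiber_eq {α κ : Type*} [Fintype α] [Fintype κ] [DecidableEq κ] (t : κ → ℕ)
    (h : ∑ k, t k = Fintype.card α) : ∃ f : α → κ, ∀ k, #{x | f x = k} = t k := by
  have e : (Σ k, Fin (t k)) ≃ α := Fintype.equivOfCardEq (by simpa using h)
  refine ⟨fun x => (e.symm x).1, fun k => ?_⟩
  rw [← Fintype.card_subtype, ← Fintype.card_fin (t k)]
  exact Fintype.card_congr
    ((e.symm.subtypeEquiv fun _ => Iff.rfl).trans (Equiv.sigmaSubtype k))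

/-- The fibre of `π ∘ F` is the union of the fibres of `F` over the fibre of `π`. -/
theorem card_fiber_comp {α κ ι : Type*} [Fintype α] [Fintype κ] [DecidableEq κ] [DecidableEq ι]
    (F : α → κ) (π : κ → ι) (i : ι) :
    #{x | π (F x) = i} = ∑ p with π p = i, #{x | F x = p} := by
  rw [Finset.card_eq_sum_card_fiberwise (f := F) (t := {p | π p = i})
    (fun x hx => by simpa using hx)]
  refine Finset.sum_congr rfl fun p hp => congrArg card ?_
  ext x
  simp only [mem_filter, mem_univ, true_and] at hp ⊢
  exact ⟨And.right, fun hx => ⟨hx ▸ hp, hx⟩⟩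

/-- Pairs `(g, h)` for which the joint colouring `(c ∘ g⁻¹, c, c ∘ h)` has fibre sizes `t`,
counted with multiplicity `∏ p, (t p)!`. -/
theorem card_pairs_mul_prod_factorial {α κ : Type*} [Fintype α] [DecidableEq α] [Fintype κ]
    [DecidableEq κ] (c : α → κ) (t : κ × κ × κ → ℕ)
    (h₁ : ∀ i, ∑ p with p.1 = i, t p = #{x | c x = i})
    (h₂ : ∀ j, ∑ p with p.2.1 = j, t p = #{x | c x = j})
    (h₃ : ∀ k, ∑ p with p.2.2 = k, t p = #{x | c x = k}) :
    #{gh : Equiv.Perm α × Equiv.Perm α |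
        ∀ p, #{x | (c (gh.1⁻¹ x), c x, c (gh.2 x)) = p} = t p} * ∏ p, (t p).factorial =
      (∏ j, (#{x | c x = j}).factorial) ^ 3 := by
  have total : ∑ p, t p = Fintype.card α := by
    rw [← Finset.sum_fiberwise (s := univ) (g := fun p : κ × κ × κ => p.1),
      Finset.sum_congr rfl fun i _ => h₁ i]
    exact (Finset.card_eq_sum_card_fiberwise (f := c) (t := univ) (fun _ _ => by simp)).symm
  obtain ⟨F, hF⟩ := exists_card_fiber_eq t total
  have fibers (π : κ × κ × κ → κ) (hπ : ∀ i, ∑ p with π p = i, t p = #{x | c x = i}) :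
      #{σ : Equiv.Perm α | c ∘ σ = π ∘ F} = ∏ j, (#{x | c x = j}).factorial :=
    card_perm_comp_eq c (π ∘ F) fun i => by
      rw [← hπ i]
      exact (card_fiber_comp F π i).trans (Finset.sum_congr rfl fun p _ => hF p)
  let T : Finset ((Equiv.Perm α × Equiv.Perm α) × Equiv.Perm α) :=
    {q | (fun x => (c (q.1.1⁻¹ x), c x, c (q.1.2 x))) ∘ q.2 = F}
  have hT : #T = (∏ j, (#{x | c x = j}).factorial) ^ 3 := by
    have : #T = #(({σ : Equiv.Perm α | c ∘ σ = (fun p => p.1) ∘ F} : Finset _) ×ˢ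
        ({σ : Equiv.Perm α | c ∘ σ = (fun p => p.2.1) ∘ F} : Finset _) ×ˢ
        ({σ : Equiv.Perm α | c ∘ σ = (fun p => p.2.2) ∘ F} : Finset _)) := by
      refine Finset.card_nbij' (fun q => (q.1.1⁻¹ * q.2, q.2, q.1.2 * q.2))
        (fun r => ((r.2.1 * r.1⁻¹, r.2.2 * r.2.1⁻¹), r.2.1)) ?_ ?_ ?_ ?_
      · rintro ⟨⟨g, h⟩, s⟩ hq
        simp only [T, coe_filter, mem_univ, true_and, Set.mem_ofPred_eq] at hq
        subst hq
        simp [funext_iff]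
      · rintro ⟨u, s, w⟩ hr
        simp only [coe_product, Set.mem_prod, coe_filter, mem_univ, true_and, Set.mem_ofPred_eq,
          funext_iff, Function.comp_apply] at hr
        simp only [T, coe_filter, mem_univ, true_and, Set.mem_ofPred_eq, funext_iff,
          Function.comp_apply, mul_inv_rev, inv_inv, Equiv.Perm.mul_apply,
          hr.1, hr.2.1, hr.2.2]
        simp
      · rintro ⟨⟨g, h⟩, s⟩ -
        simp
      · rintro ⟨u, s, w⟩ -
        simp
    rw [this, card_product, card_product, fibers _ h₁, fibers _ h₂, fibers _ h₃]
    ring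
  rw [← hT, Finset.card_eq_sum_card_fiberwise (f := Prod.fst) (s := T)
    (t := {gh : Equiv.Perm α × Equiv.Perm α |
        ∀ p, #{x | (c (gh.1⁻¹ x), c x, c (gh.2 x)) = p} = t p}), Finset.sum_const_nat]
  · rintro ⟨g, h⟩ hgh
    simp only [mem_filter, mem_univ, true_and] at hgh
    rw [← Finset.prod_congr rfl fun p _ => congrArg Nat.factorial (hgh p),
      ← card_perm_comp_eq _ F fun p => (hF p).trans (hgh p).symm]
    refine Finset.card_nbij' Prod.snd (fun s => ((g, h), s)) ?_ ?_ ?_ ?_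
    · rintro ⟨q, s⟩ hq
      simp only [T, coe_filter, mem_filter, mem_univ, true_and, Set.mem_ofPred_eq] at hq ⊢
      obtain ⟨hq, rfl⟩ := hq
      exact hq
    · intro s hs
      simpa [T] using hs
    · rintro ⟨q, s⟩ hq
      simp only [coe_filter, Set.mem_ofPred_eq] at hq
      simp [hq.2]
    · intro s _
      rfl
  · rintro ⟨⟨g, h⟩, s⟩ hq
    simp only [T, coe_filter, mem_univ, true_and, Set.mem_ofPred_eq] at hq ⊢
    exact fun p => (card_fiber_eq_of_comp_eq hq p).symm.trans (hF p)

theorem stmt3 (ν : ℕ) (hν : 1 ≤ ν) (n : Fin ν → ℕ) (hn : ∀ j, 1 ≤ n j)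
    (Ω : Type) [Fintype Ω] [DecidableEq Ω] (P : Fin ν → Finset Ω)
    (hP : IsPartition n P)
    (a b : Fin ν → Fin ν → ℕ) (ha : IsDC n a) (hb : IsDC n b)
    (t : Fin ν → Fin ν → Fin ν → ℕ)
    (hta : ∀ i j, ∑ k, t i j k = a i j) (htb : ∀ j k, ∑ i, t i j k = b j k) :
    ((Finset.univ.filter (fun gh : Equiv.Perm Ω × Equiv.Perm Ω =>
        (∀ i j, countMat P gh.1 i j = a i j) ∧
        (∀ j k, countMat P gh.2 j k = b j k) ∧
        (∀ i j k, ((P i).image ⇑gh.1 ∩ P j ∩ (P k).image ⇑(gh.2⁻¹)).card = t i j k))).card : ℚ)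
      = ((∏ j, ((n j).factorial : ℚ)) / ∏ i, ∏ j, ∏ k, ((t i j k).factorial : ℚ)) ^ 3 *
          ∏ i, ∏ j, ∏ k, ((t i j k).factorial : ℚ) ^ 2 := by
  obtain ⟨hdisj, hcov, hcard⟩ := hP
  choose c hc using hcov
  have hmem : ∀ x j, x ∈ P j ↔ c x = j := fun x j =>
    ⟨fun hx => by
      by_contra hne
      exact Finset.disjoint_left.1 (hdisj _ _ hne) (hc x) hx, fun hx => hx ▸ hc x⟩
  have himage (g : Equiv.Perm Ω) (i : Fin ν) (x : Ω) :
      x ∈ (P i).image g ↔ c (g⁻¹ x) = i := by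
    rw [← hmem, Finset.mem_image]
    exact ⟨by rintro ⟨y, hy, rfl⟩; simpa using hy, fun hx => ⟨_, hx, by simp⟩⟩
  have hn' : ∀ j, #{x | c x = j} = n j := fun j => by
    rw [← hcard j]
    congr 1
    ext x
    simp [hmem]
  have hinter (g h : Equiv.Perm Ω) (i j k : Fin ν) :
      #((P i).image g ∩ P j ∩ (P k).image ⇑h⁻¹) =
        #{x | (c (g⁻¹ x), c x, c (h x)) = (i, j, k)} := by
    congr 1
    ext x
    simp [himage, hmem, -mem_image]
  have hcount₁ (g h : Equiv.Perm Ω) (i j : Fin ν) :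
      countMat P g i j = ∑ k, #((P i).image g ∩ P j ∩ (P k).image ⇑h⁻¹) := by
    rw [countMat, Finset.card_eq_sum_card_fiberwise (f := fun x => c (h x)) (t := univ)
      (fun _ _ => by simp)]
    refine Finset.sum_congr rfl fun k _ => congrArg card ?_
    ext x
    simp only [mem_filter, mem_inter, himage, inv_inv]
  have hcount₂ (g h : Equiv.Perm Ω) (j k : Fin ν) :
      countMat P h j k = ∑ i, #((P i).image g ∩ P j ∩ (P k).image ⇑h⁻¹) := by
    have : countMat P h j k = #(P j ∩ (P k).image ⇑h⁻¹) := by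
      rw [countMat]
      refine Finset.card_equiv h⁻¹ fun x => ?_
      simp [himage, hmem, -mem_image]
    rw [this, Finset.card_eq_sum_card_fiberwise (f := fun x => c (g⁻¹ x)) (t := univ)
      (fun _ _ => by simp)]
    refine Finset.sum_congr rfl fun i _ => congrArg card ?_
    ext x
    simp only [mem_filter, mem_inter, himage, hmem]
    tauto
  have key := card_pairs_mul_prod_factorial c (fun p => t p.1 p.2.1 p.2.2)
    (fun i => by
      rw [hn', ← ha.2 i, Finset.sum_filter, Fintype.sum_prod_type]
      simp [Fintype.sum_prod_type, hta, Finset.sum_ite_irrel])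
    (fun j => by
      rw [hn', ← ha.1 j, Finset.sum_filter, Fintype.sum_prod_type]
      simp [Fintype.sum_prod_type, hta, Finset.sum_ite_irrel])
    (fun k => by
      rw [hn', ← hb.1 k, Finset.sum_filter, Fintype.sum_prod_type, Finset.sum_congr rfl
        fun i _ => Fintype.sum_prod_type _, Finset.sum_comm]
      simp [htb])
  have hset : (Finset.univ.filter (fun gh : Equiv.Perm Ω × Equiv.Perm Ω =>
        (∀ i j, countMat P gh.1 i j = a i j) ∧
        (∀ j k, countMat P gh.2 j k = b j k) ∧
        (∀ i j k, ((P i).image ⇑gh.1 ∩ P j ∩ (P k).image ⇑(gh.2⁻¹)).card = t i j k))) =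
      Finset.univ.filter (fun gh : Equiv.Perm Ω × Equiv.Perm Ω =>
        ∀ p : Fin ν × Fin ν × Fin ν,
          #{x | (c (gh.1⁻¹ x), c x, c (gh.2 x)) = p} = t p.1 p.2.1 p.2.2) := by
    refine Finset.filter_congr fun gh _ => ⟨fun H p => ?_, fun H => ?_⟩
    · rw [← H.2.2, hinter]
    · have H' : ∀ i j k, #((P i).image gh.1 ∩ P j ∩ (P k).image ⇑gh.2⁻¹) = t i j k :=
        fun i j k => (hinter _ _ i j k).trans (H (i, j, k))
      refine ⟨fun i j => ?_, fun j k => ?_, H'⟩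
      · rw [hcount₁ gh.1 gh.2, ← hta, Finset.sum_congr rfl fun k _ => H' i j k]
      · rw [hcount₂ gh.1 gh.2, ← htb, Finset.sum_congr rfl fun i _ => H' i j k]
  rw [hset]
  simp only [hn', Fintype.prod_prod_type] at key
  have keyQ := congrArg (Nat.cast (R := ℚ)) key
  push_cast at keyQ
  have hne : (∏ i, ∏ j, ∏ k, ((t i j k).factorial : ℚ)) ≠ 0 := by
    simp [Finset.prod_ne_zero_iff, Nat.factorial_ne_zero]
  simp only [Finset.prod_pow]
  rw [div_pow, ← keyQ]
  field_simp
end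

section
/- For ν = 2 and 0 ≤ a, b ≤ min(n_1, n_2), one has φ_a · φ_b = Σ_c s_ab^c φ_c in ℚ[Sym(Ω)], where the sum is over 0 ≤ c ≤ min(n_1, n_2) and s_ab^c = [(a! b!)² (n_1−a)! (n_2−a)! (n_1−b)! (n_2−b)! / (n_1! n_2!)] · Σ_{σ,τ} 1 / [σ! τ! (a−σ)! (b−σ)! (a−τ)! (b−τ)! (n_1−a−b+τ)! (n_2−a−b+σ)!], the sum being over all pairs of integers (σ, τ) with 0 ≤ σ, τ ≤ min(a, b), σ + τ = a + b − c, n_1 − a − b + τ ≥ 0, and n_2 − a − b + σ ≥ 0. -/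
open Finset

def xiFinset {Ω : Type} [Fintype Ω] [DecidableEq Ω] {ν : ℕ}
    (P : Fin ν → Finset Ω) (a : Fin ν → Fin ν → ℕ) : Finset (Equiv.Perm Ω) :=
  Finset.univ.filter (fun g => ∀ i j, countMat P g i j = a i j)

noncomputable def muC {ν : ℕ} (n : Fin ν → ℕ) (a : Fin ν → Fin ν → ℕ) : ℚ :=
  (∏ j, ((n j).factorial : ℚ)) ^ 2 / ∏ i, ∏ j, ((a i j).factorial : ℚ)

noncomputable def XiElt {Ω : Type} [Fintype Ω] [DecidableEq Ω] {ν : ℕ}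
    (n : Fin ν → ℕ) (P : Fin ν → Finset Ω) (a : Fin ν → Fin ν → ℕ) :
    MonoidAlgebra ℚ (Equiv.Perm Ω) :=
  (muC n a)⁻¹ • ∑ g ∈ xiFinset P a, MonoidAlgebra.of ℚ (Equiv.Perm Ω) g

/-- The matrix `[[n₁ − a, a], [a, n₂ − a]]`. -/
def phiMat (n : Fin 2 → ℕ) (a : ℕ) : Fin 2 → Fin 2 → ℕ :=
  fun i j => if i = j then n i - a else a

/-- The structure constants `s_{ab}^c` for `ν = 2`, as a sum over pairs `(σ, τ)`. -/
noncomputable def sTwo (n : Fin 2 → ℕ) (a b c : ℕ) : ℚ :=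
  ((a.factorial * b.factorial : ℚ) ^ 2 * ((n 0 - a).factorial : ℚ) *
      ((n 1 - a).factorial : ℚ) * ((n 0 - b).factorial : ℚ) * ((n 1 - b).factorial : ℚ)) /
    (((n 0).factorial : ℚ) * ((n 1).factorial : ℚ)) *
  ∑ p ∈ (Finset.range (min a b + 1) ×ˢ Finset.range (min a b + 1)).filter
      (fun p => p.1 + p.2 + c = a + b ∧ a + b ≤ n 0 + p.2 ∧ a + b ≤ n 1 + p.1),
    1 / ((p.1.factorial : ℚ) * (p.2.factorial : ℚ) * ((a - p.1).factorial : ℚ) *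
      ((b - p.1).factorial : ℚ) * ((a - p.2).factorial : ℚ) * ((b - p.2).factorial : ℚ) *
      ((n 0 + p.2 - (a + b)).factorial : ℚ) * ((n 1 + p.1 - (a + b)).factorial : ℚ))

/-- Moving a set by a permutation and comparing with a second set is the same as comparing with
the inverse image of the second set. -/
theorem card_image_perm_sdiff {Ω : Type} [DecidableEq Ω] (g : Equiv.Perm Ω) (E A : Finset Ω) :
    (E.image g \ A).card = (E \ A.image ⇑g⁻¹).card := by
  rw [← card_image_of_injective (E \ A.image ⇑g⁻¹) g.injective,
    image_sdiff _ _ g.injective, image_image]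
  congr 2
  simp [Function.comp_def]

theorem card_image_inv_sdiff {Ω : Type} [DecidableEq Ω] (g : Equiv.Perm Ω) (A : Finset Ω) :
    (A.image ⇑g⁻¹ \ A).card = (A.image g \ A).card := by
  rw [card_image_perm_sdiff g]
  exact card_sdiff_comm (card_image_of_injective _ (Equiv.injective _))

/-- The number of permutations preserving a finite set. -/
theorem card_perm_image_eq_self {Ω : Type} [Fintype Ω] [DecidableEq Ω] (A : Finset Ω) :
    (univ.filter fun k : Equiv.Perm Ω => A.image k = A).card =
      A.card.factorial * Aᶜ.card.factorial := by
  have h := DomMulAct.stabilizer_card (fun x : Ω => decide (x ∈ A))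
  rw [Fintype.card_subtype] at h
  have hfilter : (univ.filter fun k : Equiv.Perm Ω => A.image k = A) =
      univ.filter fun k : Equiv.Perm Ω =>
        (fun x : Ω => decide (x ∈ A)) ∘ k = fun x : Ω => decide (x ∈ A) := by
    ext k
    simp only [mem_filter, mem_univ, true_and, funext_iff, Function.comp_apply, decide_eq_decide]
    constructor
    · intro hk x
      conv_lhs => rw [← hk]
      simp
    · intro hk
      exact eq_of_subset_of_card_le (image_subset_iff.2 fun x hx => (hk x).2 hx)
        (card_image_of_injective _ k.injective).ge
  rw [hfilter, h]
  rw [Fintype.prod_bool]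
  simp only [Fintype.card_subtype, decide_eq_true_eq, decide_eq_false_iff_not]
  congr 3 <;> ext x <;> simp

/-- The number of permutations carrying one finite set onto another of the same size. -/
theorem card_perm_image_eq {Ω : Type} [Fintype Ω] [DecidableEq Ω] (A E : Finset Ω)
    (hE : E.card = A.card) :
    (univ.filter fun k : Equiv.Perm Ω => A.image k = E).card =
      A.card.factorial * Aᶜ.card.factorial := by
  obtain ⟨m, hm⟩ : ∃ m : Equiv.Perm Ω, A.image m = E := by
    let e := Finset.equivOfCardEq hE.symm
    refine ⟨e.extendSubtype, ?_⟩
    refine eq_of_subset_of_card_le ?_ ?_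
    · intro x hx
      obtain ⟨y, hy, rfl⟩ := mem_image.1 hx
      exact e.extendSubtype_mem y hy
    · rw [card_image_of_injective _ (Equiv.injective _), hE]
  rw [← card_perm_image_eq_self A]
  refine card_nbij' (m⁻¹ * ·) (m * ·) ?_ ?_ ?_ ?_
  · intro k hk
    simp only [coe_filter, mem_univ, true_and, Set.mem_ofPred_eq] at hk ⊢
    rw [Equiv.Perm.coe_mul, ← image_image, hk, ← hm, image_image]
    simp [Function.comp_def]
  · intro k hk
    simp only [coe_filter, mem_univ, true_and, Set.mem_ofPred_eq] at hk ⊢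
    rw [Equiv.Perm.coe_mul, ← image_image, hk, hm]
  · intro k _; simp
  · intro k _; simp

/-- Counting sets by the sizes of their traces on the four regions cut out by two sets. -/
theorem card_filter_traces {Ω : Type} [Fintype Ω] [DecidableEq Ω] (A C : Finset Ω)
    (x y z w : ℕ) :
    (univ.filter fun E : Finset Ω => (E ∩ (A ∩ C)).card = x ∧ (E ∩ (A \ C)).card = y ∧
      (E ∩ (C \ A)).card = z ∧ (E \ (A ∪ C)).card = w).card =
    (A ∩ C).card.choose x * (A \ C).card.choose y * (C \ A).card.choose z *
      (A ∪ C)ᶜ.card.choose w := by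
  rw [← card_powersetCard, ← card_powersetCard, ← card_powersetCard, ← card_powersetCard,
    ← card_product, ← card_product, ← card_product]
  refine card_nbij'
    (fun E => (((E ∩ (A ∩ C), E ∩ (A \ C)), E ∩ (C \ A)), E \ (A ∪ C)))
    (fun q => q.1.1.1 ∪ q.1.1.2 ∪ q.1.2 ∪ q.2) ?_ ?_ ?_ ?_
  · intro E hE
    simp only [coe_filter, mem_univ, true_and, Set.mem_ofPred_eq] at hE
    obtain ⟨h1, h2, h3, h4⟩ := hE
    simp only [mem_coe, mem_product, mem_powersetCard]
    refine ⟨⟨⟨⟨inter_subset_right, h1⟩, inter_subset_right, h2⟩, inter_subset_right, h3⟩, ?_, h4⟩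
    intro u hu
    simpa using (mem_sdiff.1 hu).2
  · rintro ⟨⟨⟨X, Y⟩, Z⟩, W⟩ hq
    simp only [mem_coe, mem_product, mem_powersetCard] at hq
    obtain ⟨⟨⟨⟨hX, rfl⟩, hY, rfl⟩, hZ, rfl⟩, hW, rfl⟩ := hq
    simp only [coe_filter, mem_univ, true_and, Set.mem_ofPred_eq]
    refine ⟨?_, ?_, ?_, ?_⟩ <;> congr 1 <;> ext u <;>
      have h1 := @hX u <;> have h2 := @hY u <;> have h3 := @hZ u <;> have h4 := @hW u <;>
      simp only [mem_inter, mem_sdiff, mem_compl, mem_union] at * <;> tauto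
  · intro E _
    ext u
    simp only [mem_inter, mem_sdiff, mem_union]
    tauto
  · rintro ⟨⟨⟨X, Y⟩, Z⟩, W⟩ hq
    simp only [mem_coe, mem_product, mem_powersetCard] at hq
    obtain ⟨⟨⟨⟨hX, -⟩, hY, -⟩, hZ, -⟩, hW, -⟩ := hq
    simp only [Prod.mk.injEq]
    refine ⟨⟨⟨?_, ?_⟩, ?_⟩, ?_⟩ <;> ext u <;>
      have h1 := @hX u <;> have h2 := @hY u <;> have h3 := @hZ u <;> have h4 := @hW u <;>
      simp only [mem_inter, mem_sdiff, mem_compl, mem_union] at * <;> tauto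

/-- The pairs `(σ, τ)` indexing the sum that defines `sTwo n a b c`. -/
def pairIndex (n : Fin 2 → ℕ) (a b c : ℕ) : Finset (ℕ × ℕ) :=
  (Finset.range (min a b + 1) ×ˢ Finset.range (min a b + 1)).filter
      (fun p => p.1 + p.2 + c = a + b ∧ a + b ≤ n 0 + p.2 ∧ a + b ≤ n 1 + p.1)

/-- The number of sets of the size of `A` at prescribed distances from two sets `A` and `C`. -/
theorem card_filter_distances {Ω : Type} [Fintype Ω] [DecidableEq Ω] (n : Fin 2 → ℕ)
    (A C : Finset Ω) (hA : A.card = n 0) (hAc : Aᶜ.card = n 1) (hC : C.card = n 0)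
    (a b : ℕ) :
    (univ.filter fun E : Finset Ω => E.card = n 0 ∧ (E \ A).card = b ∧ (E \ C).card = a).card =
      ∑ p ∈ pairIndex n a b (A \ C).card,
        (A ∩ C).card.choose (n 0 + p.2 - (a + b)) * (A \ C).card.choose (a - p.2) *
          (C \ A).card.choose (b - p.2) * (A ∪ C)ᶜ.card.choose p.2 := by
  have hACi : (A ∩ C).card + (A \ C).card = n 0 := by rw [card_inter_add_card_sdiff, hA]
  have hCA : (C \ A).card = (A \ C).card := card_sdiff_comm (hC.trans hA.symm)
  have hout : (C \ A).card + (A ∪ C)ᶜ.card = n 1 := by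
    rw [← hAc, ← card_inter_add_card_sdiff Aᶜ C]
    congr 2 <;> (ext u; simp only [mem_inter, mem_sdiff, mem_compl, mem_union]; tauto)
  have traces : ∀ E : Finset Ω,
      E.card = (E ∩ (A ∩ C)).card + (E ∩ (A \ C)).card + (E ∩ (C \ A)).card +
        (E \ (A ∪ C)).card ∧
      (E \ A).card = (E ∩ (C \ A)).card + (E \ (A ∪ C)).card ∧
      (E \ C).card = (E ∩ (A \ C)).card + (E \ (A ∪ C)).card := by
    intro E
    have e1 := card_inter_add_card_sdiff E A
    have e2 := card_inter_add_card_sdiff (E ∩ A) C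
    have e3 := card_inter_add_card_sdiff (E \ A) C
    have e4 := card_inter_add_card_sdiff (E \ C) A
    have s1 : E ∩ A ∩ C = E ∩ (A ∩ C) := inter_assoc ..
    have s2 : (E ∩ A) \ C = E ∩ (A \ C) := by ext u; simp; tauto
    have s3 : (E \ A) ∩ C = E ∩ (C \ A) := by ext u; simp; tauto
    have s4 : (E \ A) \ C = E \ (A ∪ C) := by ext u; simp; tauto
    have s5 : (E \ C) ∩ A = E ∩ (A \ C) := by ext u; simp; tauto
    have s6 : (E \ C) \ A = E \ (A ∪ C) := by ext u; simp; tauto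
    rw [s1, s2] at e2
    rw [s3, s4] at e3
    rw [s5, s6] at e4
    omega
  have bounds : ∀ E : Finset Ω, (E ∩ (A ∩ C)).card ≤ (A ∩ C).card ∧
      (E ∩ (A \ C)).card ≤ (A \ C).card ∧ (E ∩ (C \ A)).card ≤ (C \ A).card ∧
      (E \ (A ∪ C)).card ≤ (A ∪ C)ᶜ.card := fun E =>
    ⟨card_le_card inter_subset_right, card_le_card inter_subset_right,
      card_le_card inter_subset_right,
      card_le_card fun u hu => by simpa using (mem_sdiff.1 hu).2⟩
  rw [card_eq_sum_card_fiberwise (t := pairIndex n a b (A \ C).card)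
    (f := fun E => (a + b - (A \ C).card - (E \ (A ∪ C)).card, (E \ (A ∪ C)).card))]
  · refine sum_congr rfl fun p hp => ?_
    rw [← card_filter_traces, filter_filter]
    congr 1
    ext E
    obtain ⟨t1, t2, t3⟩ := traces E
    simp only [pairIndex, mem_filter, mem_product, mem_range] at hp
    simp only [mem_filter, mem_univ, true_and, Prod.ext_iff]
    omega
  · intro E hE
    obtain ⟨t1, t2, t3⟩ := traces E
    obtain ⟨b1, b2, b3, b4⟩ := bounds E
    simp only [coe_filter, mem_univ, true_and, Set.mem_ofPred_eq] at hE
    simp only [pairIndex, mem_coe, mem_filter, mem_product, mem_range]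
    omega

/-- The number of factorizations of `g` in terms of sets at prescribed distances. -/
theorem card_filter_perm_distances {Ω : Type} [Fintype Ω] [DecidableEq Ω] (A : Finset Ω)
    (g : Equiv.Perm Ω) (a b : ℕ) :
    (univ.filter fun k : Equiv.Perm Ω =>
      (A.image ⇑(g * k⁻¹) \ A).card = a ∧ (A.image k \ A).card = b).card =
    (univ.filter fun E : Finset Ω =>
      E.card = A.card ∧ (E \ A).card = b ∧ (E \ A.image ⇑g⁻¹).card = a).card *
      (A.card.factorial * Aᶜ.card.factorial) := by
  rw [card_eq_sum_card_fiberwise (t := univ.filter fun E : Finset Ω =>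
      E.card = A.card ∧ (E \ A).card = b ∧ (E \ A.image ⇑g⁻¹).card = a)
    (f := fun k : Equiv.Perm Ω => A.image ⇑k⁻¹)]
  · rw [← smul_eq_mul, ← sum_const]
    refine sum_congr rfl fun E hE => ?_
    simp only [mem_filter, mem_univ, true_and] at hE
    obtain ⟨h1, h2, h3⟩ := hE
    rw [← card_perm_image_eq A E h1, filter_filter]
    refine card_nbij' (·⁻¹) (·⁻¹) ?_ ?_ ?_ ?_
    · intro k hk
      simp only [coe_filter, mem_univ, true_and, Set.mem_ofPred_eq] at hk ⊢
      exact hk.2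
    · intro k hk
      simp only [coe_filter, mem_univ, true_and, Set.mem_ofPred_eq] at hk ⊢
      rw [inv_inv, card_image_inv_sdiff, hk, Equiv.Perm.coe_mul, ← image_image, hk,
        card_image_perm_sdiff]
      exact ⟨⟨h3, h2⟩, rfl⟩
    · intro k _; simp
    · intro k _; simp
  · intro k hk
    simp only [coe_filter, mem_univ, true_and, Set.mem_ofPred_eq] at hk ⊢
    obtain ⟨h1, h2⟩ := hk
    rw [Equiv.Perm.coe_mul, ← image_image, card_image_perm_sdiff] at h1
    exact ⟨card_image_of_injective _ (Equiv.injective _), by rw [card_image_inv_sdiff, h2], h1⟩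

theorem IsPartition.compl_eq {Ω : Type} [Fintype Ω] [DecidableEq Ω] {n : Fin 2 → ℕ}
    {P : Fin 2 → Finset Ω} (hP : IsPartition n P) : (P 0)ᶜ = P 1 := by
  ext u
  obtain ⟨j, hj⟩ := hP.2.1 u
  have h : u ∈ P 0 → u ∉ P 1 := fun hu => disjoint_left.1 (hP.1 0 1 (by decide)) hu
  rw [mem_compl]
  fin_cases j
  · have hj : u ∈ P 0 := hj
    tauto
  · have hj : u ∈ P 1 := hj
    tauto

theorem IsPartition.card_image_sdiff_le {Ω : Type} [Fintype Ω] [DecidableEq Ω] {n : Fin 2 → ℕ}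
    {P : Fin 2 → Finset Ω} (hP : IsPartition n P) (g : Equiv.Perm Ω) :
    ((P 0).image g \ P 0).card ≤ min (n 0) (n 1) := by
  refine le_min ?_ ?_
  · rw [← hP.2.2 0, ← card_image_of_injective (P 0) g.injective]
    exact card_le_card sdiff_subset
  · rw [← hP.2.2 1, ← hP.compl_eq]
    exact card_le_card fun u hu => by simpa using (mem_sdiff.1 hu).2

theorem IsPartition.mem_xiFinset_phiMat {Ω : Type} [Fintype Ω] [DecidableEq Ω] {n : Fin 2 → ℕ}
    {P : Fin 2 → Finset Ω} (hP : IsPartition n P) (g : Equiv.Perm Ω) (a : ℕ) :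
    g ∈ xiFinset P (phiMat n a) ↔ ((P 0).image g \ P 0).card = a := by
  have c0 : (P 0).card = n 0 := hP.2.2 0
  have c1 : (P 1).card = n 1 := hP.2.2 1
  have hle := hP.card_image_sdiff_le g
  have himage : (P 1).image g = ((P 0).image g)ᶜ := by
    rw [← hP.compl_eq, compl_eq_univ_sdiff, image_sdiff _ _ g.injective,
      image_univ_of_surjective g.surjective, ← compl_eq_univ_sdiff]
  have i0 : ((P 0).image g).card = n 0 := by rw [card_image_of_injective _ g.injective, c0]
  have e1 := card_inter_add_card_sdiff ((P 0).image g) (P 0)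
  have e2 := card_inter_add_card_sdiff (P 0) ((P 0).image g)
  have e3 := card_inter_add_card_sdiff (P 1) ((P 0).image g)
  have s1 : (P 0).image g ∩ P 1 = (P 0).image g \ P 0 := by
    ext u; simp [← hP.compl_eq]
  have s2 : ((P 0).image g)ᶜ ∩ P 0 = P 0 \ (P 0).image g := by
    ext u; simp [and_comm]
  have s3 : ((P 0).image g)ᶜ ∩ P 1 = P 1 \ (P 0).image g := by
    ext u; simp [and_comm]
  rw [inter_comm, s1] at e3
  rw [inter_comm] at e2
  simp only [xiFinset, mem_filter, mem_univ, true_and, Fin.forall_fin_two, countMat, phiMat,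
    himage, s1, s2, s3]
  simp only [Fin.isValue, if_true, zero_ne_one, one_ne_zero, if_false]
  omega

theorem coeff_XiElt {Ω : Type} [Fintype Ω] [DecidableEq Ω] {ν : ℕ} (n : Fin ν → ℕ)
    (P : Fin ν → Finset Ω) (a : Fin ν → Fin ν → ℕ) (g : Equiv.Perm Ω) :
    (XiElt n P a).coeff g = if g ∈ xiFinset P a then (muC n a)⁻¹ else 0 := by
  simp [XiElt, MonoidAlgebra.coeff_sum, MonoidAlgebra.of_apply, Finsupp.single_apply]

theorem coeff_XiElt_mul {Ω : Type} [Fintype Ω] [DecidableEq Ω] {ν : ℕ} (n : Fin ν → ℕ)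
    (P : Fin ν → Finset Ω) (a b : Fin ν → Fin ν → ℕ) (g : Equiv.Perm Ω) :
    (XiElt n P a * XiElt n P b).coeff g = (muC n a)⁻¹ * (muC n b)⁻¹ *
      (univ.filter fun k => g * k⁻¹ ∈ xiFinset P a ∧ k ∈ xiFinset P b).card := by
  conv_lhs => rw [XiElt.eq_1 n P b]
  rw [mul_smul_comm, mul_sum, MonoidAlgebra.coeff_smul_apply, MonoidAlgebra.coeff_sum,
    Finsupp.finsetSum_apply]
  simp only [MonoidAlgebra.of_apply, MonoidAlgebra.coeff_mul_single_apply, coeff_XiElt, mul_one]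
  rw [← sum_filter, sum_const, nsmul_eq_mul, smul_eq_mul]
  have hfilter : (univ.filter fun k => g * k⁻¹ ∈ xiFinset P a ∧ k ∈ xiFinset P b) =
      (xiFinset P b).filter fun k => g * k⁻¹ ∈ xiFinset P a := by
    ext k
    simp [and_comm]
  rw [hfilter]
  ring

/-- The binomial coefficients of a pair `(σ, τ)` in terms of factorials. -/
theorem choose_prod_eq {m l a b c s t : ℕ} (h : s + t + c = a + b) (hs : s ≤ min a b)
    (ht : t ≤ min a b) (hm : a + b ≤ m + t) (hl : a + b ≤ l + s) :
    (((m - c).choose (m + t - (a + b)) * c.choose (a - t) * c.choose (b - t) *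
      (l - c).choose t : ℕ) : ℚ) =
    ((m - c).factorial * (l - c).factorial * (c.factorial : ℚ) ^ 2) *
      (1 / ((s.factorial : ℚ) * (t.factorial : ℚ) * ((a - s).factorial : ℚ) *
      ((b - s).factorial : ℚ) * ((a - t).factorial : ℚ) * ((b - t).factorial : ℚ) *
      ((m + t - (a + b)).factorial : ℚ) * ((l + s - (a + b)).factorial : ℚ))) := by
  push_cast
  rw [Nat.cast_choose ℚ (show m + t - (a + b) ≤ m - c by omega),
    Nat.cast_choose ℚ (show a - t ≤ c by omega), Nat.cast_choose ℚ (show b - t ≤ c by omega),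
    Nat.cast_choose ℚ (show t ≤ l - c by omega),
    show m - c - (m + t - (a + b)) = s by omega, show c - (a - t) = b - s by omega,
    show c - (b - t) = a - s by omega, show l - c - t = l + s - (a + b) by omega]
  field_simp

theorem muC_phiMat (n : Fin 2 → ℕ) (a : ℕ) :
    muC n (phiMat n a) = (((n 0).factorial : ℚ) * (n 1).factorial) ^ 2 /
      ((n 0 - a).factorial * (n 1 - a).factorial * (a.factorial : ℚ) ^ 2) := by
  simp only [muC, phiMat, Fin.prod_univ_two]
  simp only [Fin.isValue, if_true, zero_ne_one, one_ne_zero, if_false]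
  congr 1
  ring

theorem stmt5 (n : Fin 2 → ℕ) (hn : ∀ j, 1 ≤ n j)
    (Ω : Type) [Fintype Ω] [DecidableEq Ω] (P : Fin 2 → Finset Ω)
    (hP : IsPartition n P)
    (a b : ℕ) (ha : a ≤ min (n 0) (n 1)) (hb : b ≤ min (n 0) (n 1)) :
    XiElt n P (phiMat n a) * XiElt n P (phiMat n b) =
      ∑ c ∈ Finset.range (min (n 0) (n 1) + 1), sTwo n a b c • XiElt n P (phiMat n c) := by
  have c0 : (P 0).card = n 0 := hP.2.2 0
  have c1 : (P 0)ᶜ.card = n 1 := by rw [hP.compl_eq, hP.2.2 1]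
  refine MonoidAlgebra.coeff_injective (Finsupp.ext fun g => ?_)
  have hc := hP.card_image_sdiff_le g
  have hg := card_image_perm_sdiff g (P 0) (P 0)
  have hcard : ((P 0).image ⇑g⁻¹).card = n 0 := by
    rw [card_image_of_injective _ (Equiv.injective _), c0]
  have hinv := card_sdiff_comm (hcard.trans c0.symm)
  have hinter := card_inter_add_card_sdiff (P 0) ((P 0).image ⇑g⁻¹)
  have hout : ((P 0).image ⇑g⁻¹ \ P 0).card + (P 0 ∪ (P 0).image ⇑g⁻¹)ᶜ.card = n 1 := by
    rw [← c1, ← card_inter_add_card_sdiff (P 0)ᶜ ((P 0).image ⇑g⁻¹)]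
    congr 2 <;> (ext u; simp only [mem_inter, mem_sdiff, mem_compl, mem_union]; tauto)
  have hcount := card_filter_distances n (P 0) ((P 0).image ⇑g⁻¹) c0 c1 hcard a b
  rw [coeff_XiElt_mul, MonoidAlgebra.coeff_sum, Finsupp.finsetSum_apply]
  simp only [MonoidAlgebra.coeff_smul_apply, coeff_XiElt, hP.mem_xiFinset_phiMat, smul_eq_mul,
    mul_ite, mul_zero]
  rw [card_filter_perm_distances, sum_ite_eq, if_pos (mem_range.2 (by omega)), c0, c1, hcount]
  rw [hg]
  rw [hg] at hc
  rw [hinv] at hout ⊢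
  generalize ((P 0) \ (P 0).image ⇑g⁻¹).card = c at *
  rw [show (P 0 ∩ (P 0).image ⇑g⁻¹).card = n 0 - c by omega,
    show (P 0 ∪ (P 0).image ⇑g⁻¹)ᶜ.card = n 1 - c by omega, Nat.cast_mul, Nat.cast_sum]
  have hsum := sum_congr (rfl : pairIndex n a b c = _) fun p hp => by
    simp only [pairIndex, mem_filter, mem_product, mem_range] at hp
    exact choose_prod_eq (m := n 0) (l := n 1) hp.2.1 (by omega) (by omega) hp.2.2.1 hp.2.2.2
  rw [hsum, ← mul_sum, sTwo, ← pairIndex, muC_phiMat, muC_phiMat, muC_phiMat]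
  generalize (∑ p ∈ pairIndex n a b c, _ : ℚ) = S
  push_cast
  field_simp
end

section
/- (Theorem 2, relation (8)) Let i, j, k ∈ {1, …, ν} be pairwise distinct, and pick points x_i ∈ P_i, x_j ∈ P_j, x_k ∈ P_k. For p ≠ q among {i, j, k} set r̃_pq := n_p n_q · Π·(x_p x_q)·Π ∈ ℚ[Sym(Ω)], where (x_p x_q) is the transposition of x_p and x_q. Then [r̃_ij, r̃_jk + r̃_ik] = 0, i.e., r̃_ij·(r̃_jk + r̃_ik) = (r̃_jk + r̃_ik)·r̃_ij. -/
open Finset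

def youngFinset {Ω : Type} [Fintype Ω] [DecidableEq Ω] {ν : ℕ} (P : Fin ν → Finset Ω) :
    Finset (Equiv.Perm Ω) :=
  Finset.univ.filter (fun g => ∀ j, (P j).image ⇑g = P j)

noncomputable def PiElt {Ω : Type} [Fintype Ω] [DecidableEq Ω] {ν : ℕ}
    (n : Fin ν → ℕ) (P : Fin ν → Finset Ω) : MonoidAlgebra ℚ (Equiv.Perm Ω) :=
  (∏ j, ((n j).factorial : ℚ))⁻¹ •
    ∑ h ∈ youngFinset P, MonoidAlgebra.of ℚ (Equiv.Perm Ω) h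

/-- The element `r̃_pq = n_p n_q · Π (x_p x_q) Π` of `ℚ[Sym(Ω)]`. -/
noncomputable def rTilde {Ω : Type} [Fintype Ω] [DecidableEq Ω] {ν : ℕ}
    (n : Fin ν → ℕ) (P : Fin ν → Finset Ω) (p q : Fin ν) (xp xq : Ω) :
    MonoidAlgebra ℚ (Equiv.Perm Ω) :=
  ((n p : ℚ) * (n q : ℚ)) •
    (PiElt n P * MonoidAlgebra.of ℚ (Equiv.Perm Ω) (Equiv.swap xp xq) * PiElt n P)

/-- The sum `∑_{x ∈ A, y ∈ B} (x y)` in `ℚ[Sym(Ω)]`. -/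
noncomputable def swapSum {Ω : Type} [Fintype Ω] [DecidableEq Ω] (A B : Finset Ω) :
    MonoidAlgebra ℚ (Equiv.Perm Ω) :=
  ∑ x ∈ A, ∑ y ∈ B, MonoidAlgebra.of ℚ (Equiv.Perm Ω) (Equiv.swap x y)

theorem sum_comp_perm_of_image_eq {Ω M : Type} [DecidableEq Ω] [AddCommMonoid M]
    {A : Finset Ω} {σ : Equiv.Perm Ω} (hA : A.image ⇑σ = A) (f : Ω → M) :
    ∑ x ∈ A, f (σ x) = ∑ x ∈ A, f x := by
  conv_rhs => rw [← hA]
  rw [Finset.sum_image σ.injective.injOn]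

theorem image_swap_of_mem {Ω : Type} [DecidableEq Ω] {A : Finset Ω} {x y : Ω}
    (hx : x ∈ A) (hy : y ∈ A) : A.image ⇑(Equiv.swap x y) = A := by
  refine Finset.eq_of_subset_of_card_le (fun z hz => ?_)
    (Finset.card_image_of_injective _ (Equiv.injective _)).ge
  obtain ⟨w, hw, rfl⟩ := Finset.mem_image.1 hz
  rw [Equiv.swap_apply_def]
  split_ifs <;> assumption

theorem image_swap_of_notMem {Ω : Type} [DecidableEq Ω] {A : Finset Ω} {x y : Ω}
    (hx : x ∉ A) (hy : y ∉ A) : A.image ⇑(Equiv.swap x y) = A := by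
  refine Finset.eq_of_subset_of_card_le (fun z hz => ?_)
    (Finset.card_image_of_injective _ (Equiv.injective _)).ge
  obtain ⟨w, hw, rfl⟩ := Finset.mem_image.1 hz
  rwa [Equiv.swap_apply_of_ne_of_ne (ne_of_mem_of_not_mem hw hx) (ne_of_mem_of_not_mem hw hy)]

theorem of_commute_swapSum {Ω : Type} [Fintype Ω] [DecidableEq Ω] {A B : Finset Ω}
    {σ : Equiv.Perm Ω} (hA : A.image ⇑σ = A) (hB : B.image ⇑σ = B) :
    Commute (MonoidAlgebra.of ℚ (Equiv.Perm Ω) σ) (swapSum A B) := by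
  have h (x y : Ω) : MonoidAlgebra.of ℚ (Equiv.Perm Ω) σ *
      MonoidAlgebra.of ℚ (Equiv.Perm Ω) (Equiv.swap x y) =
      MonoidAlgebra.of ℚ (Equiv.Perm Ω) (Equiv.swap (σ x) (σ y)) *
        MonoidAlgebra.of ℚ (Equiv.Perm Ω) σ := by
    rw [← map_mul, ← map_mul, Equiv.mul_swap_eq_swap_mul]
  unfold Commute SemiconjBy swapSum
  simp only [Finset.mul_sum, Finset.sum_mul, h]
  rw [sum_comp_perm_of_image_eq hA (fun x => ∑ y ∈ B,
    MonoidAlgebra.of ℚ (Equiv.Perm Ω) (Equiv.swap x (σ y)) * MonoidAlgebra.of ℚ (Equiv.Perm Ω) σ)]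
  exact Finset.sum_congr rfl fun x _ => sum_comp_perm_of_image_eq hB (fun y =>
    MonoidAlgebra.of ℚ (Equiv.Perm Ω) (Equiv.swap x y) * MonoidAlgebra.of ℚ (Equiv.Perm Ω) σ)

section Partition

variable {Ω : Type} [Fintype Ω] [DecidableEq Ω] {ν : ℕ} {n : Fin ν → ℕ} {P : Fin ν → Finset Ω}

theorem mem_youngFinset {g : Equiv.Perm Ω} :
    g ∈ youngFinset P ↔ ∀ j, (P j).image ⇑g = P j := by
  simp [youngFinset]

theorem mul_mem_youngFinset {g h : Equiv.Perm Ω} (hg : g ∈ youngFinset P)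
    (hh : h ∈ youngFinset P) : g * h ∈ youngFinset P := by
  rw [mem_youngFinset] at *
  intro j
  rw [Equiv.Perm.coe_mul, ← Finset.image_image, hh, hg]

theorem inv_mem_youngFinset {g : Equiv.Perm Ω} (hg : g ∈ youngFinset P) :
    g⁻¹ ∈ youngFinset P := by
  rw [mem_youngFinset] at *
  intro j
  conv_lhs => rw [← hg j]
  rw [Finset.image_image, ← Equiv.Perm.coe_mul, inv_mul_cancel, Equiv.Perm.coe_one,
    Finset.image_id]

theorem PiElt_mul_of {g : Equiv.Perm Ω} (hg : g ∈ youngFinset P) :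
    PiElt n P * MonoidAlgebra.of ℚ (Equiv.Perm Ω) g = PiElt n P := by
  unfold PiElt
  rw [smul_mul_assoc, Finset.sum_mul]
  congr 1
  refine Finset.sum_nbij' (· * g) (· * g⁻¹) (fun h hh => mul_mem_youngFinset hh hg)
    (fun h hh => mul_mem_youngFinset hh (inv_mem_youngFinset hg)) ?_ ?_ ?_
  · simp
  · simp
  · intro h _
    rw [map_mul]

theorem of_mul_PiElt {g : Equiv.Perm Ω} (hg : g ∈ youngFinset P) :
    MonoidAlgebra.of ℚ (Equiv.Perm Ω) g * PiElt n P = PiElt n P := by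
  unfold PiElt
  rw [mul_smul_comm, Finset.mul_sum]
  congr 1
  refine Finset.sum_nbij' (g * ·) (g⁻¹ * ·) (fun h hh => mul_mem_youngFinset hg hh)
    (fun h hh => mul_mem_youngFinset (inv_mem_youngFinset hg) hh) ?_ ?_ ?_
  · simp
  · simp
  · intro h _
    rw [map_mul]

theorem PiElt_commute_swapSum (p q : Fin ν) :
    Commute (PiElt n P) (swapSum (P p) (P q)) :=
  (Commute.sum_left _ _ _ fun _ hh =>
    of_commute_swapSum (mem_youngFinset.1 hh p) (mem_youngFinset.1 hh q)).smul_left _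

theorem PiElt_mul_of_conj_mul_PiElt {g : Equiv.Perm Ω} (hg : g ∈ youngFinset P) (x y : Ω) :
    PiElt n P * MonoidAlgebra.of ℚ (Equiv.Perm Ω) (Equiv.swap (g x) (g y)) * PiElt n P =
      PiElt n P * MonoidAlgebra.of ℚ (Equiv.Perm Ω) (Equiv.swap x y) * PiElt n P := by
  conv_lhs => arg 2; rw [← of_mul_PiElt hg]
  rw [← mul_assoc, mul_assoc (PiElt n P), ← map_mul, ← Equiv.mul_swap_eq_swap_mul, map_mul,
    ← mul_assoc, PiElt_mul_of hg]

theorem swap_mem_youngFinset (hP : ∀ i j, i ≠ j → Disjoint (P i) (P j)) {p : Fin ν} {x y : Ω}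
    (hx : x ∈ P p) (hy : y ∈ P p) : Equiv.swap x y ∈ youngFinset P := by
  rw [mem_youngFinset]
  intro j
  by_cases h : p = j
  · subst h
    exact image_swap_of_mem hx hy
  · exact image_swap_of_notMem (Finset.disjoint_left.1 (hP p j h) hx)
      (Finset.disjoint_left.1 (hP p j h) hy)

theorem rTilde_eq_swapSum_mul (hP : IsPartition n P) {p q : Fin ν} (hpq : p ≠ q) {xp xq : Ω}
    (hp : xp ∈ P p) (hq : xq ∈ P q) :
    rTilde n P p q xp xq = swapSum (P p) (P q) * (PiElt n P * PiElt n P) := by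
  have key : ∀ x ∈ P p, ∀ y ∈ P q,
      PiElt n P * MonoidAlgebra.of ℚ (Equiv.Perm Ω) (Equiv.swap x y) * PiElt n P =
      PiElt n P * MonoidAlgebra.of ℚ (Equiv.Perm Ω) (Equiv.swap xp xq) * PiElt n P := by
    intro x hx y hy
    have hd := hP.1 p q hpq
    have ne {a b : Ω} (ha : a ∈ P p) (hb : b ∈ P q) : a ≠ b := by
      rintro rfl
      exact Finset.disjoint_left.1 hd ha hb
    have h := PiElt_mul_of_conj_mul_PiElt (n := n)
      (mul_mem_youngFinset (swap_mem_youngFinset hP.1 hp hx)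
        (swap_mem_youngFinset hP.1 hq hy)) xp xq
    rwa [Equiv.Perm.mul_apply, Equiv.Perm.mul_apply, Equiv.swap_apply_left,
      Equiv.swap_apply_of_ne_of_ne (ne hp hq) (ne hp hy), Equiv.swap_apply_left,
      Equiv.swap_apply_of_ne_of_ne (ne hp hy).symm (ne hx hy).symm] at h
  rw [← mul_assoc, ← (PiElt_commute_swapSum p q).eq, swapSum]
  simp only [Finset.mul_sum, Finset.sum_mul]
  rw [Finset.sum_congr rfl fun x hx => Finset.sum_congr rfl fun y hy => key x hx y hy]
  rw [Finset.sum_const, Finset.sum_const, hP.2.2, hP.2.2, rTilde, smul_smul,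
    ← Nat.cast_smul_eq_nsmul ℚ, Nat.cast_mul]

end Partition

theorem swapSum_commute_swapSum_union {Ω : Type} [Fintype Ω] [DecidableEq Ω] {A B C : Finset Ω}
    (hAC : Disjoint A C) (hBC : Disjoint B C) :
    Commute (swapSum A B) (swapSum (A ∪ B) C) := by
  refine Commute.sum_left _ _ _ fun x hx => Commute.sum_left _ _ _ fun y hy => ?_
  exact of_commute_swapSum
    (image_swap_of_mem (Finset.mem_union_left _ hx) (Finset.mem_union_right _ hy))
    (image_swap_of_notMem (Finset.disjoint_left.1 hAC hx) (Finset.disjoint_left.1 hBC hy))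

theorem stmt8 (ν : ℕ) (hν : 3 ≤ ν) (n : Fin ν → ℕ) (hn : ∀ j, 1 ≤ n j)
    (Ω : Type) [Fintype Ω] [DecidableEq Ω] (P : Fin ν → Finset Ω)
    (hP : IsPartition n P)
    (i j k : Fin ν) (hij : i ≠ j) (hjk : j ≠ k) (hik : i ≠ k)
    (xi xj xk : Ω) (hxi : xi ∈ P i) (hxj : xj ∈ P j) (hxk : xk ∈ P k) :
    rTilde n P i j xi xj * (rTilde n P j k xj xk + rTilde n P i k xi xk) =
      (rTilde n P j k xj xk + rTilde n P i k xi xk) * rTilde n P i j xi xj := by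
  rw [rTilde_eq_swapSum_mul hP hij hxi hxj, rTilde_eq_swapSum_mul hP hjk hxj hxk,
    rTilde_eq_swapSum_mul hP hik hxi hxk, ← add_mul]
  have hsum : swapSum (P j) (P k) + swapSum (P i) (P k) = swapSum (P i ∪ P j) (P k) := by
    rw [add_comm, swapSum, swapSum, swapSum, Finset.sum_union (hP.1 i j hij)]
  have hPi (p q : Fin ν) : Commute (PiElt n P * PiElt n P) (swapSum (P p) (P q)) :=
    (PiElt_commute_swapSum p q).mul_left (PiElt_commute_swapSum p q)
  have hcomm : Commute (swapSum (P i) (P j)) (swapSum (P j) (P k) + swapSum (P i) (P k)) := by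
    rw [hsum]
    exact swapSum_commute_swapSum_union (hP.1 i k hik) (hP.1 j k hjk)
  exact ((hcomm.mul_right (hPi i j).symm).mul_left
    (((hPi j k).add_right (hPi i k)).mul_right (Commute.refl _))).eq
end

section
/- (Theorem 4b, vanishing) Let n_1, …, n_ν ≥ 1 be integers and let a, b, c ∈ B satisfy a*_jj ≤ n_j and b*_jj ≤ n_j for all j, while c*_jj > n_j for some j. Then the rational function 𝔰_{a,b}^c ∈ ℚ(ε_1, …, ε_ν) is regular at the point (ε_1, …, ε_ν) = (1/n_1, …, 1/n_ν) (i.e., it can be written as a quotient p/q of polynomials with q(1/n_1, …, 1/n_ν) ≠ 0) and its value there is 0. -/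
open Finset

/-- The set `B`: collections `{a_ij}` (with zero diagonal, encoding indexing by pairs `i ≠ j`)
of nonnegative integers with `Σ_{i≠j} a_ij = Σ_{i≠j} a_ji` for each `j`. -/
def Bdiag (ν : ℕ) (a : Fin ν → Fin ν → ℕ) : Prop :=
  (∀ j, a j j = 0) ∧
  ∀ j, ∑ i ∈ Finset.univ.filter (· ≠ j), a i j = ∑ i ∈ Finset.univ.filter (· ≠ j), a j i

/-- `a*_jj = Σ_{i ≠ j} a_ji`. -/
def astar {ν : ℕ} (a : Fin ν → Fin ν → ℕ) (j : Fin ν) : ℕ :=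
  ∑ i ∈ Finset.univ.filter (· ≠ j), a j i

/-- Membership in the set `T(a, b, c)`: collections `{t_ijk}` (with `t_jjj = 0`, encoding
indexing by triples not all equal) satisfying the defining relations. -/
def memT {ν : ℕ} (a b c : Fin ν → Fin ν → ℕ) (t : Fin ν → Fin ν → Fin ν → ℕ) : Prop :=
  (∀ j, t j j j = 0) ∧
  (∀ j k, j ≠ k → ∑ i, t i j k = b j k) ∧
  (∀ i k, i ≠ k → ∑ j, t i j k = c i k) ∧
  (∀ i j, i ≠ j → ∑ k, t i j k = a i j) ∧
  (∀ j, astar a j + ∑ k ∈ Finset.univ.filter (· ≠ j), t j j k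
      = astar b j + ∑ i ∈ Finset.univ.filter (· ≠ j), t i j j) ∧
  (∀ j, astar a j + ∑ k ∈ Finset.univ.filter (· ≠ j), t j j k
      = astar c j + ∑ m ∈ Finset.univ.filter (· ≠ j), t j m m)

/-- The common value `t*_jjj`. -/
def tstar {ν : ℕ} (a : Fin ν → Fin ν → ℕ) (t : Fin ν → Fin ν → Fin ν → ℕ) (j : Fin ν) : ℕ :=
  astar a j + ∑ k ∈ Finset.univ.filter (· ≠ j), t j j k

/-- The field `ℚ(ε_1, …, ε_ν)` of rational functions in `ν` variables. -/
abbrev RatFunField (ν : ℕ) := FractionRing (MvPolynomial (Fin ν) ℚ)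

/-- The variable `ε_j`. -/
noncomputable def eps (ν : ℕ) (j : Fin ν) : RatFunField ν :=
  algebraMap (MvPolynomial (Fin ν) ℚ) (RatFunField ν) (MvPolynomial.X j)

/-- `((p, q; x)) = ∏_{m=p}^{q-1} (1 - m x)`. -/
noncomputable def dpoch (ν : ℕ) (p q : ℕ) (x : RatFunField ν) : RatFunField ν :=
  ∏ m ∈ Finset.Ico p q, (1 - (m : RatFunField ν) * x)

/-- The structure constant `𝔰_{a,b}^c ∈ ℚ(ε_1, …, ε_ν)`. -/
noncomputable def sConst {ν : ℕ} (a b c : Fin ν → Fin ν → ℕ) : RatFunField ν :=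
  ∑ᶠ (t : Fin ν → Fin ν → Fin ν → ℕ) (_ : memT a b c t),
    ((∏ i, ∏ j, ((a i j).factorial : RatFunField ν)) *
        (∏ j, ∏ k, ((b j k).factorial : RatFunField ν)) /
          ∏ i, ∏ j, ∏ k, ((t i j k).factorial : RatFunField ν)) *
      ∏ j, (eps ν j ^ (astar a j + astar b j - tstar a t j) *
        (dpoch ν (astar a j) (tstar a t j) (eps ν j) *
            dpoch ν (astar b j) (tstar a t j) (eps ν j) /
          dpoch ν 0 (tstar a t j) (eps ν j)))

/-- The rational function `x` is regular at the point `v`, with value `z` there. -/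
def HasValueAt {ν : ℕ} (v : Fin ν → ℚ) (x : RatFunField ν) (z : ℚ) : Prop :=
  ∃ p q : MvPolynomial (Fin ν) ℚ,
    MvPolynomial.eval v q ≠ 0 ∧
    x = algebraMap (MvPolynomial (Fin ν) ℚ) (RatFunField ν) p /
        algebraMap (MvPolynomial (Fin ν) ℚ) (RatFunField ν) q ∧
    MvPolynomial.eval v p / MvPolynomial.eval v q = z

namespace HasValueAt

variable {ν : ℕ} {v : Fin ν → ℚ} {x y : RatFunField ν} {z w : ℚ}

theorem algebraMap_ne_zero {q : MvPolynomial (Fin ν) ℚ} (hq : MvPolynomial.eval v q ≠ 0) :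
    algebraMap (MvPolynomial (Fin ν) ℚ) (RatFunField ν) q ≠ 0 := by
  intro h
  rw [FaithfulSMul.algebraMap_eq_zero_iff] at h
  simp [h] at hq

theorem of_polynomial (v : Fin ν → ℚ) (p : MvPolynomial (Fin ν) ℚ) :
    HasValueAt v (algebraMap _ (RatFunField ν) p) (MvPolynomial.eval v p) :=
  ⟨p, 1, by simp, by simp, by simp⟩

theorem natCast (v : Fin ν → ℚ) (m : ℕ) : HasValueAt v (m : RatFunField ν) m := by
  simpa using of_polynomial v (m : MvPolynomial (Fin ν) ℚ)

theorem zero (v : Fin ν → ℚ) : HasValueAt v 0 0 := by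
  simpa using natCast v 0

theorem one (v : Fin ν → ℚ) : HasValueAt v 1 1 := by
  simpa using natCast v 1

theorem eps (v : Fin ν → ℚ) (j : Fin ν) : HasValueAt v (eps ν j) (v j) := by
  simpa [_root_.eps] using of_polynomial v (MvPolynomial.X j)

theorem add (hx : HasValueAt v x z) (hy : HasValueAt v y w) : HasValueAt v (x + y) (z + w) := by
  obtain ⟨p, q, hq, rfl, rfl⟩ := hx
  obtain ⟨r, s, hs, rfl, rfl⟩ := hy
  refine ⟨p * s + q * r, q * s, by simp [hq, hs], ?_, ?_⟩
  · rw [div_add_div _ _ (algebraMap_ne_zero hq) (algebraMap_ne_zero hs)]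
    simp only [map_add, map_mul]
  · rw [div_add_div _ _ hq hs]
    simp only [map_add, map_mul]

theorem mul (hx : HasValueAt v x z) (hy : HasValueAt v y w) : HasValueAt v (x * y) (z * w) := by
  obtain ⟨p, q, hq, rfl, rfl⟩ := hx
  obtain ⟨r, s, hs, rfl, rfl⟩ := hy
  refine ⟨p * r, q * s, by simp [hq, hs], ?_, ?_⟩
  · simp only [map_mul, div_mul_div_comm]
  · simp only [map_mul, div_mul_div_comm]

theorem sub (hx : HasValueAt v x z) (hy : HasValueAt v y w) : HasValueAt v (x - y) (z - w) := by
  have hneg : HasValueAt v (-1) (-1) := by simpa using of_polynomial v (-1)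
  simpa [sub_eq_add_neg] using hx.add (hneg.mul hy)

theorem inv (hx : HasValueAt v x z) (hz : z ≠ 0) : HasValueAt v x⁻¹ z⁻¹ := by
  obtain ⟨p, q, hq, rfl, rfl⟩ := hx
  refine ⟨q, p, fun h => hz (by simp [h]), ?_, ?_⟩ <;> rw [inv_div]

theorem div (hx : HasValueAt v x z) (hy : HasValueAt v y w) (hw : w ≠ 0) :
    HasValueAt v (x / y) (z / w) := by
  simpa only [div_eq_mul_inv] using hx.mul (hy.inv hw)

theorem prod {ι : Type*} (s : Finset ι) {f : ι → RatFunField ν} {g : ι → ℚ}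
    (h : ∀ i ∈ s, HasValueAt v (f i) (g i)) :
    HasValueAt v (∏ i ∈ s, f i) (∏ i ∈ s, g i) := by
  classical
  induction s using Finset.induction_on with
  | empty => simpa using one v
  | insert i s hi ih =>
    rw [Finset.prod_insert hi, Finset.prod_insert hi]
    exact (h i (by simp)).mul (ih fun k hk => h k (by simp [hk]))

theorem pow (hx : HasValueAt v x z) (m : ℕ) : HasValueAt v (x ^ m) (z ^ m) := by
  simpa using prod (Finset.range m) fun _ _ => hx

theorem dpoch (v : Fin ν → ℚ) (p q : ℕ) (j : Fin ν) :
    HasValueAt v (dpoch ν p q (_root_.eps ν j)) (∏ m ∈ Finset.Ico p q, (1 - (m : ℚ) * v j)) :=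
  prod _ fun m _ => (one v).sub ((natCast v m).mul (eps v j))

theorem ne_zero (hx : HasValueAt v x z) (hz : z ≠ 0) : x ≠ 0 := by
  obtain ⟨p, q, hq, rfl, rfl⟩ := hx
  rw [div_eq_mul_inv] at hz
  exact div_ne_zero (algebraMap_ne_zero (left_ne_zero_of_mul hz)) (algebraMap_ne_zero hq)

theorem finsum {ι : Sort*} {f : ι → RatFunField ν} (h : ∀ i, HasValueAt v (f i) 0) :
    HasValueAt v (∑ᶠ i, f i) 0 :=
  finsum_induction (fun x => HasValueAt v x 0) (zero v)
    (fun _ _ hx hy => by simpa using hx.add hy) h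

end HasValueAt

theorem dpoch_eps_ne_zero {ν : ℕ} (p q : ℕ) (j : Fin ν) : dpoch ν p q (eps ν j) ≠ 0 :=
  (HasValueAt.dpoch 0 p q j).ne_zero (by simp)

theorem dpoch_mul_div_dpoch {ν : ℕ} {p q : ℕ} (r : ℕ) (h : p ≤ q) (j : Fin ν) :
    dpoch ν p q (eps ν j) * dpoch ν r q (eps ν j) / dpoch ν 0 q (eps ν j) =
      dpoch ν r q (eps ν j) / dpoch ν 0 p (eps ν j) := by
  have hsplit : dpoch ν 0 q (eps ν j) = dpoch ν 0 p (eps ν j) * dpoch ν p q (eps ν j) :=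
    (Finset.prod_Ico_consecutive _ (Nat.zero_le p) h).symm
  rw [hsplit, mul_comm, mul_div_mul_right _ _ (dpoch_eps_ne_zero p q j)]

theorem prod_one_sub_div_ne_zero {m n : ℕ} (h : m ≤ n) :
    ∏ k ∈ Finset.Ico 0 m, (1 - (k : ℚ) * (1 / (n : ℚ))) ≠ 0 := by
  refine Finset.prod_ne_zero_iff.mpr fun k hk => ?_
  have hkn : k < n := (Finset.mem_Ico.mp hk).2.trans_le h
  have hn : (n : ℚ) ≠ 0 := by
    have : n ≠ 0 := by omega
    exact_mod_cast this
  rw [mul_one_div, sub_ne_zero, ne_comm, Ne, div_eq_one_iff_eq hn]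
  exact_mod_cast hkn.ne

theorem prod_one_sub_div_eq_zero {m n q : ℕ} (hn : 1 ≤ n) (hm : m ≤ n) (hq : n < q) :
    ∏ k ∈ Finset.Ico m q, (1 - (k : ℚ) * (1 / (n : ℚ))) = 0 := by
  refine Finset.prod_eq_zero (Finset.mem_Ico.mpr ⟨hm, hq⟩) ?_
  have : (n : ℚ) ≠ 0 := by
    have : n ≠ 0 := by omega
    exact_mod_cast this
  field_simp
  simp

theorem stmt15 (ν : ℕ) (hν : 1 ≤ ν) (n : Fin ν → ℕ) (hn : ∀ j, 1 ≤ n j)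
    (a b c : Fin ν → Fin ν → ℕ) (ha : Bdiag ν a) (hb : Bdiag ν b) (hc : Bdiag ν c)
    (han : ∀ j, astar a j ≤ n j) (hbn : ∀ j, astar b j ≤ n j)
    (hcn : ∃ j, n j < astar c j) :
    ∃ p q : MvPolynomial (Fin ν) ℚ,
      MvPolynomial.eval (fun j => 1 / (n j : ℚ)) q ≠ 0 ∧
      sConst a b c =
        algebraMap (MvPolynomial (Fin ν) ℚ) (RatFunField ν) p /
          algebraMap (MvPolynomial (Fin ν) ℚ) (RatFunField ν) q ∧
      MvPolynomial.eval (fun j => 1 / (n j : ℚ)) p /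
          MvPolynomial.eval (fun j => 1 / (n j : ℚ)) q = 0 := by
  obtain ⟨j₀, hj₀⟩ := hcn
  suffices h : HasValueAt (fun j => 1 / (n j : ℚ)) (sConst a b c) 0 from h
  refine HasValueAt.finsum fun t => HasValueAt.finsum fun ht => ?_
  have hT : n j₀ < tstar a t j₀ := by
    have := ht.2.2.2.2.2 j₀
    unfold tstar
    omega
  have hcoef := ((HasValueAt.prod Finset.univ fun i _ => HasValueAt.prod Finset.univ fun j _ =>
    HasValueAt.natCast (fun j => 1 / (n j : ℚ)) (a i j).factorial).mul
    (HasValueAt.prod Finset.univ fun i _ => HasValueAt.prod Finset.univ fun j _ =>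
      HasValueAt.natCast _ (b i j).factorial)).div
    (HasValueAt.prod Finset.univ fun i _ => HasValueAt.prod Finset.univ fun j _ =>
      HasValueAt.prod Finset.univ fun k _ => HasValueAt.natCast _ (t i j k).factorial)
    (by simp [Finset.prod_eq_zero_iff, Nat.factorial_ne_zero])
  have hfactor (j : Fin ν) := ((HasValueAt.eps (fun j => 1 / (n j : ℚ)) j).pow
    (astar a j + astar b j - tstar a t j)).mul
    ((HasValueAt.dpoch _ (astar b j) (tstar a t j) j).div
      (HasValueAt.dpoch _ 0 (astar a j) j) (prod_one_sub_div_ne_zero (han j)))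
  have hterm := hcoef.mul (HasValueAt.prod Finset.univ fun j _ => hfactor j)
  have hle (j : Fin ν) : astar a j ≤ tstar a t j := Nat.le_add_right _ _
  simp only [dpoch_mul_div_dpoch _ (hle _)]
  convert hterm using 1
  refine (mul_eq_zero_of_right _ (Finset.prod_eq_zero (Finset.mem_univ j₀) ?_)).symm
  rw [prod_one_sub_div_eq_zero (hn j₀) (hbn j₀) hT, zero_div, mul_zero]
end
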